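/- arXiv:2106.08864 — 4 statements merged into one kernel-verified Lean document; each statement's English description precedes it below -/
import Mathlib

section
/- For every δ ∈ (0,1), with probability at least 1 − δ over a sample (x_1,…,x_n) drawn i.i.d. from ν (i.e., from ν^{⊗n}): sup_{g ∈ G} |R̂̃(g) − R̃(g)| ≤ (2√2 · L_ℓ / C_r) · ∑_{y : Fin K} Rad_n(G_y, ν) + (C_ℓ / C_r) · √(log(2/δ) / (2n)). -/
open MeasureTheory

/-- Expected Rademacher complexity of a class `F` of real-valued functions on a sample of
size `n` drawn i.i.d. from `ρ`. -/
noncomputable def rademacherComplexity {X : Type*} [MeasurableSpace X] (ρ : Measure X)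
    (n : ℕ) (F : Set (X → ℝ)) : ℝ :=
  ∫ xs : Fin n → X,
    (∑ σ : Fin n → Bool,
        sSup ((fun f : X → ℝ => (∑ i, (if σ i then (1 : ℝ) else -1) * f (xs i)) / n) '' F))
      / 2 ^ n
    ∂(Measure.pi fun _ => ρ)

open scoped BigOperators

/-- The sign `±1` attached to a Boolean. -/
def boolSign (b : Bool) : ℝ := if b then 1 else -1

lemma boolSign_not (b : Bool) : boolSign (!b) = -boolSign b := by
  cases b <;> simp [boolSign]

lemma abs_boolSign (b : Bool) : |boolSign b| = 1 := by
  cases b <;> simp [boolSign]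

lemma expect_fin_succ_arrow {β : Type*} [Fintype β] (n : ℕ) (F : (Fin (n + 1) → β) → ℝ) :
    (𝔼 x, F x) = 𝔼 b, 𝔼 y : Fin n → β, F (Fin.cons b y) := by
  rw [← Finset.expect_product', Finset.univ_product_univ]
  exact (Fintype.expect_equiv (Fin.consEquiv fun _ => β) _ _ fun _ => rfl).symm

lemma expect_bool_fin_succ (n : ℕ) (F : (Fin (n + 1) → Bool) → ℝ) :
    (𝔼 x, F x) =
      𝔼 y : Fin n → Bool, (F (Fin.cons true y) + F (Fin.cons false y)) / 2 := by
  rw [expect_fin_succ_arrow, Finset.expect_comm]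
  refine Finset.expect_congr rfl fun y _ => ?_
  rw [Fintype.expect_eq_sum_div_card, Fintype.sum_bool, Fintype.card_bool, Nat.cast_ofNat]

/-- Flip the `i`-th coordinate of a point of the discrete cube. -/
def cubeFlip {n : ℕ} (i : Fin n) (x : Fin n → Bool) : Fin n → Bool :=
  Function.update x i (!x i)

lemma cubeFlip_cubeFlip {n : ℕ} (i : Fin n) (x : Fin n → Bool) :
    cubeFlip i (cubeFlip i x) = x := by
  simp [cubeFlip]

lemma cubeFlip_zero_cons {n : ℕ} (b : Bool) (y : Fin n → Bool) :
    cubeFlip 0 (Fin.cons b y : Fin (n + 1) → Bool) = Fin.cons (!b) y := by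
  simp [cubeFlip]

lemma cubeFlip_succ_cons {n : ℕ} (i : Fin n) (b : Bool) (y : Fin n → Bool) :
    cubeFlip i.succ (Fin.cons b y : Fin (n + 1) → Bool) = Fin.cons b (cubeFlip i y) := by
  simp [cubeFlip, Fin.cons_update]

lemma expect_comp_cubeFlip {n : ℕ} (i : Fin n) (F : (Fin n → Bool) → ℝ) :
    (𝔼 x, F (cubeFlip i x)) = 𝔼 x, F x :=
  Fintype.expect_equiv (Function.Involutive.toPerm _ (cubeFlip_cubeFlip i)) _ _ fun _ => rfl

lemma expect_comp_not {κ : Type*} [Fintype κ] [DecidableEq κ] (F : (κ → Bool) → ℝ) :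
    (𝔼 x : κ → Bool, F fun k => !x k) = 𝔼 x, F x :=
  Fintype.expect_equiv
    (Function.Involutive.toPerm (fun (x : κ → Bool) k => !x k) fun x => by simp) _ _
    fun _ => rfl

/-- The Dirichlet energy of a function on the discrete cube. -/
noncomputable def cubeEnergy {n : ℕ} (f : (Fin n → Bool) → ℝ) : ℝ :=
  𝔼 x, ∑ i, (f x - f (cubeFlip i x)) ^ 2

/-- The part of a function on the cube that is even in the first coordinate. -/
noncomputable def cubeEvenPart {n : ℕ} (f : (Fin (n + 1) → Bool) → ℝ) (y : Fin n → Bool) : ℝ :=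
  (f (Fin.cons true y) + f (Fin.cons false y)) / 2

/-- The part of a function on the cube that is odd in the first coordinate. -/
noncomputable def cubeOddPart {n : ℕ} (f : (Fin (n + 1) → Bool) → ℝ) (y : Fin n → Bool) : ℝ :=
  (f (Fin.cons true y) - f (Fin.cons false y)) / 2

lemma expect_eq_cubeEvenPart {n : ℕ} (f : (Fin (n + 1) → Bool) → ℝ) :
    (𝔼 x, f x) = 𝔼 y, cubeEvenPart f y :=
  expect_bool_fin_succ n f

lemma expect_sq_eq_parts {n : ℕ} (f : (Fin (n + 1) → Bool) → ℝ) :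
    (𝔼 x, f x ^ 2) = (𝔼 y, cubeEvenPart f y ^ 2) + 𝔼 y, cubeOddPart f y ^ 2 := by
  rw [expect_bool_fin_succ, ← Finset.expect_add_distrib]
  refine Finset.expect_congr rfl fun y _ => ?_
  simp only [cubeEvenPart, cubeOddPart]
  ring

lemma cubeEnergy_eq_parts {n : ℕ} (f : (Fin (n + 1) → Bool) → ℝ) :
    cubeEnergy f = cubeEnergy (cubeEvenPart f) + cubeEnergy (cubeOddPart f) +
      4 * 𝔼 y, cubeOddPart f y ^ 2 := by
  simp only [cubeEnergy]
  rw [expect_bool_fin_succ, Finset.mul_expect, ← Finset.expect_add_distrib,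
    ← Finset.expect_add_distrib]
  refine Finset.expect_congr rfl fun y _ => ?_
  simp only [Fin.sum_univ_succ, cubeFlip_zero_cons, cubeFlip_succ_cons, Bool.not_true,
    Bool.not_false]
  have h : (∑ i, (f (Fin.cons true y) - f (Fin.cons true (cubeFlip i y))) ^ 2) +
      ∑ i, (f (Fin.cons false y) - f (Fin.cons false (cubeFlip i y))) ^ 2 =
      2 * ((∑ i, (cubeEvenPart f y - cubeEvenPart f (cubeFlip i y)) ^ 2) +
        ∑ i, (cubeOddPart f y - cubeOddPart f (cubeFlip i y)) ^ 2) := by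
    rw [← Finset.sum_add_distrib, ← Finset.sum_add_distrib, Finset.mul_sum]
    refine Finset.sum_congr rfl fun i _ => ?_
    simp only [cubeEvenPart, cubeOddPart]
    ring
  have h0 : cubeOddPart f y = (f (Fin.cons true y) - f (Fin.cons false y)) / 2 := rfl
  have h1 : cubeOddPart f y ^ 2 =
    ((f (Fin.cons true y) - f (Fin.cons false y)) / 2) ^ 2 := by rw [h0]
  linarith

lemma cubeEnergy_nonneg {n : ℕ} (f : (Fin n → Bool) → ℝ) : 0 ≤ cubeEnergy f :=
  Finset.expect_nonneg fun _ _ => Finset.sum_nonneg fun _ _ => sq_nonneg _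

/-- The Poincaré inequality on the discrete cube. -/
lemma cube_poincare {n : ℕ} (f : (Fin n → Bool) → ℝ) :
    (𝔼 x, f x ^ 2) - (𝔼 x, f x) ^ 2 ≤ cubeEnergy f / 4 := by
  induction n with
  | zero => simp [cubeEnergy]
  | succ n ih =>
    rw [expect_sq_eq_parts, expect_eq_cubeEvenPart f, cubeEnergy_eq_parts]
    linarith [ih (cubeEvenPart f), cubeEnergy_nonneg (cubeOddPart f)]

/-- A Poincaré inequality with the first Walsh level singled out: the remaining nonconstant
part has spectral gap twice as large. -/
lemma cube_poincare_level_one {n : ℕ} (f : (Fin n → Bool) → ℝ) :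
    2 * ((𝔼 x, f x ^ 2) - (𝔼 x, f x) ^ 2) ≤
      cubeEnergy f / 4 + ∑ i, (𝔼 x, boolSign (x i) * f x) ^ 2 := by
  induction n with
  | zero => simp [cubeEnergy]
  | succ n ih =>
    have h0 : (𝔼 x, boolSign (x 0) * f x) = 𝔼 y, cubeOddPart f y := by
      rw [expect_bool_fin_succ]
      refine Finset.expect_congr rfl fun y _ => ?_
      simp only [Fin.cons_zero, boolSign, cubeOddPart]
      simp [sub_eq_add_neg]
    have hs (i : Fin n) : (𝔼 x, boolSign (x i.succ) * f x) =
        𝔼 y, boolSign (y i) * cubeEvenPart f y := by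
      rw [expect_bool_fin_succ]
      refine Finset.expect_congr rfl fun y _ => ?_
      simp only [Fin.cons_succ, cubeEvenPart]
      ring
    rw [expect_sq_eq_parts, expect_eq_cubeEvenPart f, cubeEnergy_eq_parts, Fin.sum_univ_succ, h0]
    simp only [hs]
    linarith [ih (cubeEvenPart f), cube_poincare (cubeOddPart f)]

lemma cubeEnergy_eq {n : ℕ} (f : (Fin n → Bool) → ℝ) :
    cubeEnergy f = 2 * 𝔼 x, f x * ∑ i, (f x - f (cubeFlip i x)) := by
  simp only [cubeEnergy, Finset.mul_sum, Finset.mul_expect]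
  rw [Finset.expect_sum_comm, Finset.expect_sum_comm]
  refine Finset.sum_congr rfl fun i _ => ?_
  have h : (𝔼 x, f (cubeFlip i x) ^ 2) = 𝔼 x, f x ^ 2 := expect_comp_cubeFlip i fun x => f x ^ 2
  calc (𝔼 x, (f x - f (cubeFlip i x)) ^ 2)
      = 𝔼 x, (2 * (f x * (f x - f (cubeFlip i x))) + (f (cubeFlip i x) ^ 2 - f x ^ 2)) :=
        Finset.expect_congr rfl fun x _ => by ring
    _ = _ := by rw [Finset.expect_add_distrib, Finset.expect_sub_distrib, h]; ring

lemma expect_sq_sum_boolSign {n : ℕ} (v : Fin n → ℝ) :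
    (𝔼 x : Fin n → Bool, (∑ k, boolSign (x k) * v k) ^ 2) = ∑ k, v k ^ 2 := by
  induction n with
  | zero => simp
  | succ n ih =>
    rw [expect_bool_fin_succ, Fin.sum_univ_succ, ← ih fun k => v k.succ]
    have : v 0 ^ 2 = 𝔼 _y : Fin n → Bool, v 0 ^ 2 := (Fintype.expect_const _).symm
    rw [this, ← Finset.expect_add_distrib]
    refine Finset.expect_congr rfl fun y _ => ?_
    simp only [Fin.sum_univ_succ, Fin.cons_zero, Fin.cons_succ, boolSign]
    simp
    ring

lemma sum_boolSign_cubeFlip {n : ℕ} (v : Fin n → ℝ) (x : Fin n → Bool) (i : Fin n) :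
    ∑ k, boolSign (cubeFlip i x k) * v k =
      (∑ k, boolSign (x k) * v k) - 2 * (boolSign (x i) * v i) := by
  have h (k : Fin n) : boolSign (cubeFlip i x k) * v k =
      boolSign (x k) * v k - if k = i then 2 * (boolSign (x i) * v i) else 0 := by
    by_cases hk : k = i
    · subst hk
      simp only [cubeFlip, Function.update_self, boolSign_not, if_true]
      ring
    · simp [cubeFlip, hk]
  simp [h]

/-- Khintchine's `L¹`-`L²` inequality with the optimal constant `√2` (Szarek), by the argument
of Latała and Oleszkiewicz. -/
lemma khintchine_sqrt_two {n : ℕ} (v : Fin n → ℝ) :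
    √(∑ k, v k ^ 2) ≤ √2 * 𝔼 x : Fin n → Bool, |∑ k, boolSign (x k) * v k| := by
  set S : (Fin n → Bool) → ℝ := fun x => ∑ k, boolSign (x k) * v k with hS
  have hodd (i : Fin n) : (𝔼 x, boolSign (x i) * |S x|) = 0 := by
    have h := expect_comp_not fun x : Fin n → Bool => boolSign (x i) * |S x|
    have h' (x : Fin n → Bool) : boolSign (!x i) * |S fun k => !x k| =
        -(boolSign (x i) * |S x|) := by
      simp [hS, boolSign_not]
    simp only [h', Finset.expect_neg_distrib] at h
    linarith
  have hen : cubeEnergy (fun x => |S x|) ≤ 2 * 𝔼 x, 2 * |S x| ^ 2 := by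
    rw [cubeEnergy_eq]
    refine mul_le_mul_of_nonneg_left (Finset.expect_le_expect fun x _ => ?_) two_pos.le
    have h1 : |∑ i, S (cubeFlip i x)| ≤ ∑ i, |S (cubeFlip i x)| :=
      Finset.abs_sum_le_sum_abs _ _
    have h2 : ∑ i, S (cubeFlip i x) = (n - 2) * S x := by
      simp only [hS, sum_boolSign_cubeFlip]
      simp [← Finset.mul_sum]
      ring
    have h3 : ((n : ℝ) - 2) * |S x| ≤ |∑ i, S (cubeFlip i x)| := by
      rw [h2, abs_mul]
      exact mul_le_mul_of_nonneg_right (le_abs_self _) (abs_nonneg _)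
    have h4 : ∑ i, (|S x| - |S (cubeFlip i x)|) ≤ 2 * |S x| := by
      simp only [Finset.sum_sub_distrib, Finset.sum_const, Finset.card_univ, Fintype.card_fin,
        nsmul_eq_mul]
      linarith
    nlinarith [mul_le_mul_of_nonneg_left h4 (abs_nonneg (S x))]
  have hmain := cube_poincare_level_one fun x => |S x|
  have hsq : (𝔼 x, |S x| ^ 2) = ∑ k, v k ^ 2 := by
    simp only [sq_abs]
    exact expect_sq_sum_boolSign v
  simp only [hodd] at hmain
  rw [← Finset.mul_expect, hsq] at hen
  rw [hsq] at hmain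
  simp only [ne_eq, OfNat.ofNat_ne_zero, not_false_eq_true, zero_pow, Finset.sum_const_zero,
    add_zero] at hmain
  refine Real.sqrt_le_iff.2 ⟨by positivity, ?_⟩
  rw [mul_pow, Real.sq_sqrt two_pos.le]
  linarith

lemma bddAbove_range_of_abs_le {ι : Type*} {F : ι → ℝ} {C : ℝ} (h : ∀ a, |F a| ≤ C) :
    BddAbove (Set.range F) :=
  ⟨C, by rintro _ ⟨a, rfl⟩; exact (le_abs_self _).trans (h a)⟩

lemma abs_sum_boolSign_mul_le {κ : Type*} [Fintype κ] {v : κ → ℝ} {C : ℝ} (h : ∀ k, |v k| ≤ C)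
    (ε : κ → Bool) : |∑ k, boolSign (ε k) * v k| ≤ Fintype.card κ * C := by
  refine (Finset.abs_sum_le_sum_abs _ _).trans ?_
  refine (Finset.sum_le_sum fun k _ => (?_ : _ ≤ C)).trans (by simp)
  rw [abs_mul, abs_boolSign, one_mul]
  exact h k

/-- The one-variable step of the vector contraction inequality. -/
lemma iSup_add_iSup_le_expect {ι : Type*} [Nonempty ι] {K : ℕ} {B ψ : ι → ℝ}
    {v : ι → EuclideanSpace ℝ (Fin K)} {L b C : ℝ} (hL : 0 ≤ L) (hB : ∀ a, |B a| ≤ b)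
    (hv : ∀ a k, |v a k| ≤ C) (hψ : ∀ a a', |ψ a - ψ a'| ≤ L * ‖v a - v a'‖) :
    (⨆ a, (B a + ψ a)) + (⨆ a, (B a - ψ a)) ≤
      2 * 𝔼 ε : Fin K → Bool, ⨆ a, (B a + √2 * L * ∑ k, boolSign (ε k) * v a k) := by
  set U : (Fin K → Bool) → ℝ := fun ε => ⨆ a, (B a + √2 * L * ∑ k, boolSign (ε k) * v a k)
    with hU
  have hle (ε : Fin K → Bool) (a : ι) :
      B a + √2 * L * ∑ k, boolSign (ε k) * v a k ≤ U ε := by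
    refine le_ciSup (f := fun a => B a + √2 * L * ∑ k, boolSign (ε k) * v a k)
      (bddAbove_range_of_abs_le (C := b + √2 * L * (Fintype.card (Fin K) * C)) fun a => ?_) a
    refine (abs_add_le _ _).trans (add_le_add (hB a) ?_)
    rw [abs_mul, abs_of_nonneg (show 0 ≤ √2 * L by positivity)]
    exact mul_le_mul_of_nonneg_left (abs_sum_boolSign_mul_le (hv a) ε) (by positivity)
  have hpair (a a' : ι) : (B a + ψ a) + (B a' - ψ a') ≤ 2 * 𝔼 ε, U ε := by
    have hk := khintchine_sqrt_two fun k => v a k - v a' k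
    have hnorm : ‖v a - v a'‖ = √(∑ k, (v a k - v a' k) ^ 2) := by
      simp [EuclideanSpace.norm_eq]
    have hsym : 2 * 𝔼 ε, U ε = 𝔼 ε, (U ε + U fun k => !ε k) := by
      rw [Finset.expect_add_distrib, expect_comp_not]
      ring
    have hlow : (𝔼 ε : Fin K → Bool, (B a + B a' +
        √2 * L * |∑ k, boolSign (ε k) * (v a k - v a' k)|)) ≤ 2 * 𝔼 ε, U ε := by
      rw [hsym]
      refine Finset.expect_le_expect fun ε _ => ?_
      have h1 := hle ε a
      have h2 := hle ε a'
      have h3 := hle (fun k => !ε k) a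
      have h4 := hle (fun k => !ε k) a'
      simp only [boolSign_not, neg_mul, Finset.sum_neg_distrib, mul_neg] at h3 h4
      simp only [mul_sub, Finset.sum_sub_distrib]
      rcases abs_cases ((∑ k, boolSign (ε k) * v a k) - ∑ k, boolSign (ε k) * v a' k) with
        h | h <;> rw [h.1] <;> linarith
    rw [Finset.expect_add_distrib, Fintype.expect_const, ← Finset.mul_expect] at hlow
    have h5 := (le_abs_self _).trans (hψ a a')
    rw [hnorm] at h5
    have h6 := mul_le_mul_of_nonneg_left hk hL
    linarith
  rw [← le_sub_iff_add_le]
  refine ciSup_le fun a => ?_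
  rw [le_sub_comm]
  refine ciSup_le fun a' => ?_
  linarith [hpair a a']

/-- Maurer's vector contraction inequality, with an arbitrary bounded offset. -/
lemma expect_iSup_add_le_vector {ι : Type*} [Nonempty ι] {K n : ℕ} {A : ι → ℝ}
    {ψ : Fin n → ι → ℝ} {v : Fin n → ι → EuclideanSpace ℝ (Fin K)} {L b C D : ℝ} (hL : 0 ≤ L)
    (hA : ∀ a, |A a| ≤ b) (hv : ∀ i a k, |v i a k| ≤ C) (hD : ∀ i a, |ψ i a| ≤ D)
    (hψ : ∀ i a a', |ψ i a - ψ i a'| ≤ L * ‖v i a - v i a'‖) :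
    (𝔼 σ : Fin n → Bool, ⨆ a, (A a + ∑ i, boolSign (σ i) * ψ i a)) ≤
      𝔼 ε : Fin n → Fin K → Bool,
        ⨆ a, (A a + √2 * L * ∑ i, ∑ k, boolSign (ε i k) * v i a k) := by
  induction n generalizing A b with
  | zero => simp
  | succ n ih =>
    have hψ0 (a : ι) : |A a + ψ 0 a| ≤ b + D :=
      (abs_add_le _ _).trans (add_le_add (hA a) (hD 0 a))
    have hψ0' (a : ι) : |A a - ψ 0 a| ≤ b + D :=
      (abs_sub _ _).trans (add_le_add (hA a) (hD 0 a))
    have ih1 := ih (ψ := fun i => ψ i.succ) (v := fun i => v i.succ) hψ0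
      (fun i => hv i.succ) (fun i => hD i.succ) fun i => hψ i.succ
    have ih2 := ih (ψ := fun i => ψ i.succ) (v := fun i => v i.succ) hψ0'
      (fun i => hv i.succ) (fun i => hD i.succ) fun i => hψ i.succ
    rw [expect_bool_fin_succ, expect_fin_succ_arrow, Finset.expect_comm]
    calc (𝔼 y : Fin n → Bool,
          ((⨆ a, (A a + ∑ i, boolSign ((Fin.cons true y : Fin (n + 1) → Bool) i) * ψ i a)) +
            ⨆ a, (A a + ∑ i, boolSign ((Fin.cons false y : Fin (n + 1) → Bool) i) * ψ i a)) / 2)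
        = ((𝔼 y : Fin n → Bool, ⨆ a, (A a + ψ 0 a + ∑ i, boolSign (y i) * ψ i.succ a)) +
            𝔼 y : Fin n → Bool, ⨆ a, (A a - ψ 0 a + ∑ i, boolSign (y i) * ψ i.succ a)) / 2 := by
          rw [← Finset.expect_add_distrib, Finset.expect_div]
          refine Finset.expect_congr rfl fun y _ => ?_
          simp [Fin.sum_univ_succ, boolSign, add_assoc, sub_eq_add_neg]
      _ ≤ ((𝔼 ε : Fin n → Fin K → Bool,
              ⨆ a, (A a + ψ 0 a + √2 * L * ∑ i, ∑ k, boolSign (ε i k) * v i.succ a k)) +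
            𝔼 ε : Fin n → Fin K → Bool,
              ⨆ a, (A a - ψ 0 a + √2 * L * ∑ i, ∑ k, boolSign (ε i k) * v i.succ a k)) / 2 := by
          linarith
      _ ≤ _ := by
          rw [← Finset.expect_add_distrib, Finset.expect_div]
          refine Finset.expect_le_expect fun ε _ => ?_
          have hB (a : ι) : |A a + √2 * L * ∑ i, ∑ k, boolSign (ε i k) * v i.succ a k| ≤
              b + √2 * L * ∑ _i : Fin n, Fintype.card (Fin K) * C := by
            refine (abs_add_le _ _).trans (add_le_add (hA a) ?_)
            rw [abs_mul, abs_of_nonneg (show 0 ≤ √2 * L by positivity)]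
            refine mul_le_mul_of_nonneg_left ?_ (by positivity)
            exact (Finset.abs_sum_le_sum_abs _ _).trans
              (Finset.sum_le_sum fun i _ => abs_sum_boolSign_mul_le (hv i.succ a) (ε i))
          have h := iSup_add_iSup_le_expect hL hB (hv 0) (hψ 0)
          simp only [Fin.sum_univ_succ, Fin.cons_zero, Fin.cons_succ, mul_add]
          simp only [add_right_comm, add_sub_right_comm, ← add_assoc] at h ⊢
          linarith

lemma expect_comp_apply {β : Type*} [Fintype β] [Nonempty β] {K : ℕ} (k : Fin K) (H : β → ℝ) :
    (𝔼 x : Fin K → β, H (x k)) = 𝔼 b, H b := by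
  rw [Fintype.expect_equiv (Equiv.funSplitAt k β) (fun x => H (x k)) (fun p => H p.1)
    fun _ => rfl, ← Finset.univ_product_univ, Finset.expect_product]
  simp

/-- Vector contraction for Rademacher averages, with one scalar average per coordinate. -/
lemma expect_iSup_le_sum_coordinates {ι : Type*} [Nonempty ι] {K n : ℕ}
    {ψ : Fin n → ι → ℝ} {v : Fin n → ι → EuclideanSpace ℝ (Fin K)} {L C D : ℝ} (hL : 0 ≤ L)
    (hv : ∀ i a k, |v i a k| ≤ C) (hD : ∀ i a, |ψ i a| ≤ D)
    (hψ : ∀ i a a', |ψ i a - ψ i a'| ≤ L * ‖v i a - v i a'‖) :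
    (𝔼 σ : Fin n → Bool, ⨆ a, ∑ i, boolSign (σ i) * ψ i a) ≤
      √2 * L * ∑ k, 𝔼 σ : Fin n → Bool, ⨆ a, ∑ i, boolSign (σ i) * v i a k := by
  have h := expect_iSup_add_le_vector (A := fun _ : ι => (0 : ℝ)) (b := 0) hL (by simp) hv hD hψ
  simp only [zero_add] at h
  refine h.trans ?_
  have hmarg (k : Fin K) : (𝔼 σ : Fin n → Bool, ⨆ a, ∑ i, boolSign (σ i) * v i a k) =
      𝔼 ε : Fin n → Fin K → Bool, ⨆ a, ∑ i, boolSign (ε i k) * v i a k := by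
    rw [← expect_comp_apply k fun σ : Fin n → Bool => ⨆ a, ∑ i, boolSign (σ i) * v i a k]
    exact Fintype.expect_equiv (Equiv.piComm fun _ _ => Bool) _ _ fun _ => rfl
  simp only [hmarg]
  rw [← Finset.expect_sum_comm, Finset.mul_expect]
  refine Finset.expect_le_expect fun ε _ => ciSup_le fun a => ?_
  refine mul_le_mul_of_nonneg_left ?_ (by positivity)
  rw [Finset.sum_comm]
  refine Finset.sum_le_sum fun k _ => ?_
  exact le_ciSup (f := fun a => ∑ i, boolSign (ε i k) * v i a k) (bddAbove_range_of_abs_le fun a =>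
    abs_sum_boolSign_mul_le (fun i => hv i a k) fun i => ε i k) a

lemma abs_iSup_le {ι : Type*} [Nonempty ι] {F : ι → ℝ} {C : ℝ} (h : ∀ a, |F a| ≤ C) :
    |⨆ a, F a| ≤ C := by
  obtain ⟨a⟩ := ‹Nonempty ι›
  exact abs_le.2 ⟨(abs_le.1 (h a)).1.trans (le_ciSup (bddAbove_range_of_abs_le h) a),
    ciSup_le fun b => (abs_le.1 (h b)).2⟩

lemma abs_sum_div_le {n : ℕ} (hn : 1 ≤ n) {u : Fin n → ℝ} {C : ℝ} (h : ∀ i, |u i| ≤ C) :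
    |(∑ i, u i) / n| ≤ C := by
  have hn' : (0 : ℝ) < n := by exact_mod_cast hn
  rw [abs_div, abs_of_pos hn', div_le_iff₀ hn', mul_comm]
  exact (Finset.abs_sum_le_sum_abs _ _).trans
    ((Finset.sum_le_sum fun i _ => h i).trans (by simp))

lemma abs_boolSign_mul (b : Bool) (s : ℝ) : |boolSign b * s| = |s| := by
  rw [abs_mul, abs_boolSign, one_mul]

lemma abs_signed_average_le {X : Type*} {n : ℕ} (hn : 1 ≤ n) {u : X → ℝ} {C : ℝ} (h : ∀ x, |u x| ≤ C)
    (σ : Fin n → Bool) (xs : Fin n → X) :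
    |(∑ i, boolSign (σ i) * u (xs i)) / n| ≤ C :=
  abs_sum_div_le hn fun _ => (abs_boolSign_mul _ _).trans_le (h _)

/-- The supremum over a class of signed averages over a sample. -/
noncomputable def signedSup {X ι : Type*} {n : ℕ} (u : ι → X → ℝ) (σ : Fin n → Bool)
    (xs : Fin n → X) : ℝ :=
  ⨆ a, (∑ i, boolSign (σ i) * u a (xs i)) / n

lemma le_signedSup {X ι : Type*} {n : ℕ} {u : ι → X → ℝ} {C : ℝ} (hn : 1 ≤ n) (h : ∀ a x, |u a x| ≤ C) (σ : Fin n → Bool) (xs : Fin n → X)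
    (a : ι) : (∑ i, boolSign (σ i) * u a (xs i)) / n ≤ signedSup u σ xs :=
  le_ciSup (f := fun a => (∑ i, boolSign (σ i) * u a (xs i)) / n)
    (bddAbove_range_of_abs_le fun a => abs_signed_average_le hn (h a) σ xs) a

lemma abs_signedSup_le {X ι : Type*} [Nonempty ι] {n : ℕ} {u : ι → X → ℝ} {C : ℝ} (hn : 1 ≤ n) (h : ∀ a x, |u a x| ≤ C) (σ : Fin n → Bool)
    (xs : Fin n → X) : |signedSup u σ xs| ≤ C :=
  abs_iSup_le fun a => abs_signed_average_le hn (h a) σ xs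

/-- The difference class of a class of functions, on pairs of points. -/
def pairDifference {X ι : Type*} (u : ι → X → ℝ) (a : ι) (p : X × X) : ℝ := u a p.1 - u a p.2

lemma abs_pairDifference_le {X ι : Type*} {u : ι → X → ℝ} {C : ℝ} (h : ∀ a x, |u a x| ≤ C) (a : ι) (p : X × X) :
    |pairDifference u a p| ≤ C + C :=
  (abs_sub _ _).trans (add_le_add (h a _) (h a _))

section Concentration

variable {X : Type*} [MeasurableSpace X]

lemma integral_comp_of_measurePreserving {Y : Type*} [MeasurableSpace Y] {P : Measure X}
    {Q : Measure Y} {T : X → Y} (hT : MeasurePreserving T P Q) {g : Y → ℝ} (hg : Measurable g) :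
    ∫ x, g (T x) ∂P = ∫ y, g y ∂Q := by
  rw [← hT.map_eq, integral_map hT.aemeasurable hg.aestronglyMeasurable]

lemma integrable_of_measurable_of_abs_le {P : Measure X} [IsFiniteMeasure P] {g : X → ℝ}
    (hg : Measurable g) {C : ℝ} (hC : ∀ x, |g x| ≤ C) : Integrable g P :=
  Integrable.of_bound hg.aestronglyMeasurable C (ae_of_all _ hC)

lemma abs_integral_le_of_abs_le {P : Measure X} [IsProbabilityMeasure P] {g : X → ℝ}
    {C : ℝ} (hC : ∀ x, |g x| ≤ C) : |∫ x, g x ∂P| ≤ C := by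
  simpa using norm_integral_le_of_norm_le_const (μ := P) (f := g) (C := C) (ae_of_all _ hC)

lemma piFinSuccAbove_zero_symm {n : ℕ} (p : X × (Fin n → X)) :
    (MeasurableEquiv.piFinSuccAbove (fun _ : Fin (n + 1) => X) 0).symm p = Fin.cons p.1 p.2 := by
  simp only [MeasurableEquiv.piFinSuccAbove, Fin.insertNthEquiv_zero]
  rfl

lemma measurable_fin_cons {n : ℕ} :
    Measurable fun p : X × (Fin n → X) => (Fin.cons p.1 p.2 : Fin (n + 1) → X) := by
  simp only [← piFinSuccAbove_zero_symm]
  exact MeasurableEquiv.measurable _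

lemma integral_pi_fin_succ (ν : Measure X) [IsProbabilityMeasure ν] {n : ℕ}
    {H : (Fin (n + 1) → X) → ℝ} (hH : Measurable H) {C : ℝ} (hC : ∀ xs, |H xs| ≤ C) :
    ∫ xs, H xs ∂(Measure.pi fun _ : Fin (n + 1) => ν) =
      ∫ x, ∫ ys, H (Fin.cons x ys) ∂(Measure.pi fun _ : Fin n => ν) ∂ν := by
  have hmp := (measurePreserving_piFinSuccAbove (fun _ : Fin (n + 1) => ν) 0).symm
  rw [← integral_comp_of_measurePreserving hmp hH, integral_prod]
  · simp only [piFinSuccAbove_zero_symm]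
  · exact integrable_of_measurable_of_abs_le (hH.comp hmp.measurable) fun _ => hC _

/-- The exponential moment bound behind McDiarmid's inequality. -/
lemma integral_exp_le_of_bounded_differences (ν : Measure X) [IsProbabilityMeasure ν] {n : ℕ}
    {F : (Fin n → X) → ℝ} (hF : Measurable F) {B c : ℝ} (hB : ∀ xs, |F xs| ≤ B)
    (hc : ∀ i xs ys, (∀ j, j ≠ i → xs j = ys j) → F xs - F ys ≤ c) (t : ℝ) :
    ∫ xs, Real.exp (t * F xs) ∂(Measure.pi fun _ => ν) ≤
      Real.exp (t * ∫ xs, F xs ∂(Measure.pi fun _ => ν)) *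
        Real.exp (n * (c / 2) ^ 2 * t ^ 2 / 2) := by
  induction n with
  | zero =>
    have hF0 : F = fun _ => F default := funext fun xs => congrArg F (Subsingleton.elim _ _)
    rw [hF0]
    simp
  | succ n ih =>
    set F₁ : X → ℝ := fun x => ∫ ys, F (Fin.cons x ys) ∂(Measure.pi fun _ : Fin n => ν) with hF₁
    have hcons : Measurable fun p : X × (Fin n → X) => F (Fin.cons p.1 p.2) :=
      hF.comp measurable_fin_cons
    have hsec (x : X) : Measurable fun ys : Fin n → X => F (Fin.cons x ys) :=
      hcons.comp measurable_prodMk_left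
    have hint (x : X) : Integrable (fun ys : Fin n → X => F (Fin.cons x ys))
        (Measure.pi fun _ => ν) :=
      integrable_of_measurable_of_abs_le (hsec x) fun _ => hB _
    have hF₁m : Measurable F₁ := (hcons.stronglyMeasurable.integral_prod_right').measurable
    have hF₁B (x : X) : |F₁ x| ≤ B := abs_integral_le_of_abs_le fun _ => hB _
    have hexp_bound (s : ℝ) (hs : |s| ≤ B) : |Real.exp (t * s)| ≤ Real.exp (|t| * B) := by
      rw [abs_of_pos (Real.exp_pos _), Real.exp_le_exp]
      refine (le_abs_self _).trans ?_
      rw [abs_mul]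
      exact mul_le_mul_of_nonneg_left hs (abs_nonneg _)
    have hosc (x x' : X) : F₁ x - F₁ x' ≤ c := by
      rw [hF₁, ← integral_sub (hint x) (hint x')]
      calc _ ≤ ∫ _ : Fin n → X, c ∂(Measure.pi fun _ => ν) := by
            refine integral_mono ((hint x).sub (hint x')) (integrable_const c) fun ys => ?_
            refine hc 0 _ _ fun j hj => ?_
            obtain ⟨k, rfl⟩ := Fin.exists_succ_eq.2 hj
            simp
        _ = c := by simp
    have : Nonempty X := ν.nonempty_of_neZero
    have hbelow : BddBelow (Set.range F₁) :=
      ⟨-B, by rintro _ ⟨x, rfl⟩; exact (abs_le.1 (hF₁B x)).1⟩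
    have hmem (x : X) : F₁ x ∈ Set.Icc (⨅ x, F₁ x) ((⨅ x, F₁ x) + c) := by
      refine ⟨ciInf_le hbelow x, ?_⟩
      rw [← sub_le_iff_le_add]
      exact le_ciInf fun x' => by linarith [hosc x x']
    have hsub := (ProbabilityTheory.hasSubgaussianMGF_of_mem_Icc (μ := ν) hF₁m.aemeasurable
      (ae_of_all _ hmem)).mgf_le t
    have hhoeff : ∫ x, Real.exp (t * F₁ x) ∂ν ≤
        Real.exp (t * ∫ x, F₁ x ∂ν) * Real.exp ((c / 2) ^ 2 * t ^ 2 / 2) := by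
      simp only [ProbabilityTheory.mgf, mul_sub, Real.exp_sub, integral_div] at hsub
      rw [div_le_iff₀ (Real.exp_pos _)] at hsub
      rw [mul_comm (Real.exp (t * _))]
      refine hsub.trans_eq ?_
      simp [div_pow]
    rw [integral_pi_fin_succ ν (by fun_prop) fun xs => hexp_bound _ (hB xs),
      integral_pi_fin_succ ν hF hB]
    have hinner (x : X) : ∫ ys, Real.exp (t * F (Fin.cons x ys)) ∂(Measure.pi fun _ => ν) ≤
        Real.exp (t * F₁ x) * Real.exp (n * (c / 2) ^ 2 * t ^ 2 / 2) :=
      ih (hsec x) (fun _ => hB _) fun i xs ys h => hc i.succ _ _ fun j => by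
        refine Fin.cases (by simp) (fun j hj => ?_) j
        simpa using h j fun h' => hj (congrArg Fin.succ h')
    have hexpm : Measurable fun p : X × (Fin n → X) => Real.exp (t * F (Fin.cons p.1 p.2)) :=
      Real.measurable_exp.comp (hcons.const_mul t)
    calc _ ≤ ∫ x, Real.exp (t * F₁ x) * Real.exp (n * (c / 2) ^ 2 * t ^ 2 / 2) ∂ν := by
          refine integral_mono ?_ ?_ hinner
          · exact integrable_of_measurable_of_abs_le
              (hexpm.stronglyMeasurable.integral_prod_right').measurable
              fun x => abs_integral_le_of_abs_le fun ys => hexp_bound _ (hB _)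
          · exact (integrable_of_measurable_of_abs_le (by fun_prop)
              fun x => hexp_bound _ (hF₁B x)).mul_const _
      _ ≤ Real.exp (t * ∫ x, F₁ x ∂ν) * Real.exp ((c / 2) ^ 2 * t ^ 2 / 2) *
            Real.exp (n * (c / 2) ^ 2 * t ^ 2 / 2) := by
          rw [integral_mul_const]
          exact mul_le_mul_of_nonneg_right hhoeff (Real.exp_pos _).le
      _ = _ := by
          rw [mul_assoc, ← Real.exp_add]
          congr 2
          push_cast
          ring

/-- McDiarmid's bounded differences inequality. -/
lemma measureReal_bounded_differences_le (ν : Measure X) [IsProbabilityMeasure ν] {n : ℕ}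
    {F : (Fin n → X) → ℝ} (hF : Measurable F) {B c : ℝ} (hB : ∀ xs, |F xs| ≤ B)
    (hc : ∀ i xs ys, (∀ j, j ≠ i → xs j = ys j) → F xs - F ys ≤ c) {ε : ℝ} (hε : 0 ≤ ε) :
    (Measure.pi fun _ => ν).real
        {xs | (∫ xs, F xs ∂(Measure.pi fun _ => ν)) + ε ≤ F xs} ≤
      Real.exp (-2 * ε ^ 2 / (n * c ^ 2)) := by
  have h : ProbabilityTheory.HasSubgaussianMGF
      (fun xs => F xs - ∫ xs, F xs ∂(Measure.pi fun _ => ν)) (n * (‖c‖₊ / 2) ^ 2)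
      (Measure.pi fun _ => ν) := by
    refine ⟨fun t => ?_, fun t => ?_⟩
    · refine integrable_of_measurable_of_abs_le (by fun_prop)
        (C := Real.exp (|t| * (B + B))) fun xs => ?_
      rw [abs_of_pos (Real.exp_pos _), Real.exp_le_exp]
      refine (le_abs_self _).trans ?_
      rw [abs_mul]
      exact mul_le_mul_of_nonneg_left ((abs_sub _ _).trans
        (add_le_add (hB xs) (abs_integral_le_of_abs_le hB))) (abs_nonneg _)
    · simp only [ProbabilityTheory.mgf, mul_sub, Real.exp_sub, integral_div]
      rw [div_le_iff₀ (Real.exp_pos _), mul_comm]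
      refine (integral_exp_le_of_bounded_differences ν hF hB hc t).trans_eq ?_
      simp [div_pow]
  have h' := h.measure_ge_le hε
  simp only [le_sub_iff_add_le'] at h'
  refine h'.trans_eq ?_
  congr 1
  push_cast
  simp only [Real.norm_eq_abs, div_pow, sq_abs]
  have h0 : 2 * ((n : ℝ) * (c ^ 2 / 2 ^ 2)) = n * c ^ 2 / 2 := by ring
  rw [h0, div_div_eq_mul_div]
  ring

/-- The largest excess of an empirical mean over the mean, over a class of functions. -/
noncomputable def supDeviation {ι : Type*} {n : ℕ} (ν : Measure X) (f : ι → X → ℝ)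
    (xs : Fin n → X) : ℝ :=
  ⨆ a, ((∑ i, f a (xs i)) / n - ∫ x, f a x ∂ν)

section Class

variable {ι : Type*} {n : ℕ} {u : ι → X → ℝ} {C : ℝ}

lemma abs_average_sub_integral_le (hn : 1 ≤ n) (h : ∀ a x, |u a x| ≤ C) (ν : Measure X)
    [IsProbabilityMeasure ν] (xs : Fin n → X) (a : ι) :
    |(∑ i, u a (xs i)) / n - ∫ x, u a x ∂ν| ≤ C + C :=
  (abs_sub _ _).trans (add_le_add (abs_sum_div_le hn fun _ => h a _)
    (abs_integral_le_of_abs_le (h a)))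

lemma le_supDeviation (hn : 1 ≤ n) (h : ∀ a x, |u a x| ≤ C) (ν : Measure X)
    [IsProbabilityMeasure ν] (xs : Fin n → X) (a : ι) :
    (∑ i, u a (xs i)) / n - ∫ x, u a x ∂ν ≤ supDeviation ν u xs :=
  le_ciSup (f := fun a => (∑ i, u a (xs i)) / n - ∫ x, u a x ∂ν)
    (bddAbove_range_of_abs_le fun a => abs_average_sub_integral_le hn h ν xs a) a

lemma measurable_pairDifference (hu : ∀ a, Measurable (u a)) (a : ι) :
    Measurable (pairDifference u a) := by
  have := hu a
  unfold pairDifference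
  fun_prop

section

variable [Nonempty ι]

lemma abs_supDeviation_le (hn : 1 ≤ n) (h : ∀ a x, |u a x| ≤ C) (ν : Measure X)
    [IsProbabilityMeasure ν] (xs : Fin n → X) : |supDeviation ν u xs| ≤ C + C :=
  abs_iSup_le fun a => abs_average_sub_integral_le hn h ν xs a

lemma supDeviation_sub_le (hn : 1 ≤ n) {M : ℝ} (h0 : ∀ a x, 0 ≤ u a x) (hM : ∀ a x, u a x ≤ M)
    (ν : Measure X) [IsProbabilityMeasure ν] (i : Fin n) (xs ys : Fin n → X)
    (hxy : ∀ j, j ≠ i → xs j = ys j) :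
    supDeviation ν u xs - supDeviation ν u ys ≤ M / n := by
  have habs (a : ι) (x : X) : |u a x| ≤ M := abs_le.2 ⟨by linarith [h0 a x, hM a x], hM a x⟩
  rw [sub_le_iff_le_add]
  refine ciSup_le fun a => ?_
  have h1 := le_supDeviation hn habs ν ys a
  have h2 : (∑ j, u a (xs j)) - ∑ j, u a (ys j) = u a (xs i) - u a (ys i) := by
    rw [← Finset.sum_sub_distrib]
    exact Finset.sum_eq_single i (fun j _ hj => by rw [hxy j hj, sub_self]) (by simp)
  have h3 : (∑ j, u a (xs j)) / n - (∑ j, u a (ys j)) / n ≤ M / n := by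
    rw [← sub_div, h2]
    exact div_le_div_of_nonneg_right (by linarith [hM a (xs i), h0 a (ys i)]) (by positivity)
  linarith

end

section

variable [Countable ι]

lemma measurable_signedSup (hu : ∀ a, Measurable (u a)) (σ : Fin n → Bool) :
    Measurable (signedSup u σ) := by
  refine Measurable.iSup fun a => ?_
  have := hu a
  fun_prop

lemma measurable_supDeviation (hu : ∀ a, Measurable (u a)) (ν : Measure X) :
    Measurable (supDeviation (n := n) ν u) := by
  refine Measurable.iSup fun a => ?_
  have := hu a
  fun_prop

lemma integral_signedSup_pairDifference_eq (hu : ∀ a, Measurable (u a))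
    (ν : Measure X) [IsProbabilityMeasure ν] (σ : Fin n → Bool) :
    ∫ z, signedSup (pairDifference u) (fun _ : Fin n => true) z
        ∂(Measure.pi fun _ => ν.prod ν) =
      ∫ z, signedSup (pairDifference u) σ z ∂(Measure.pi fun _ => ν.prod ν) := by
  have hswap (i : Fin n) : MeasurePreserving (fun p : X × X => if σ i then p else p.swap)
      (ν.prod ν) (ν.prod ν) := by
    cases σ i
    · simpa using Measure.measurePreserving_swap
    · simp only [if_true]
      exact MeasurePreserving.id _
  rw [← integral_comp_of_measurePreserving (measurePreserving_pi _ _ hswap)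
    (measurable_signedSup (measurable_pairDifference hu) _)]
  refine integral_congr_ae (ae_of_all _ fun z => ?_)
  simp only [signedSup]
  refine iSup_congr fun a => ?_
  congr 1
  refine Finset.sum_congr rfl fun i _ => ?_
  cases σ i <;> simp [boolSign, pairDifference]

end

variable [Nonempty ι] [Countable ι]

lemma integrable_signedSup (hn : 1 ≤ n) (hu : ∀ a, Measurable (u a)) (h : ∀ a x, |u a x| ≤ C)
    (P : Measure (Fin n → X)) [IsFiniteMeasure P] (σ : Fin n → Bool) :
    Integrable (signedSup u σ) P :=
  integrable_of_measurable_of_abs_le (measurable_signedSup hu σ) (abs_signedSup_le hn h σ)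

/-- The ghost sample bound. -/
lemma integral_supDeviation_le_ghost (hn : 1 ≤ n) (hu : ∀ a, Measurable (u a))
    (h : ∀ a x, |u a x| ≤ C) (ν : Measure X) [IsProbabilityMeasure ν] :
    ∫ xs, supDeviation (n := n) ν u xs ∂(Measure.pi fun _ => ν) ≤
      ∫ z, signedSup (pairDifference u) (fun _ : Fin n => true) z
        ∂(Measure.pi fun _ => ν.prod ν) := by
  set P : Measure (Fin n → X) := Measure.pi fun _ => ν with hP
  have hn' : (n : ℝ) ≠ 0 := by positivity
  have hmp := (measurePreserving_arrowProdEquivProdArrow X X (Fin n) (fun _ => ν)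
    fun _ => ν).symm
  have hm := measurable_signedSup (n := n) (measurable_pairDifference hu) fun _ => true
  have hb := abs_signedSup_le (n := n) hn (abs_pairDifference_le h) fun _ => true
  have hmc := hm.comp hmp.measurable
  have hint : Integrable (fun p => signedSup (pairDifference u) (fun _ => true)
      ((MeasurableEquiv.arrowProdEquivProdArrow X X (Fin n)).symm p)) (P.prod P) :=
    integrable_of_measurable_of_abs_le hmc fun _ => hb _
  rw [← integral_comp_of_measurePreserving hmp hm, integral_prod _ hint]
  refine integral_mono
    (integrable_of_measurable_of_abs_le (measurable_supDeviation hu ν)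
      (abs_supDeviation_le hn h ν))
    hint.integral_prod_left fun xs => ciSup_le fun a => ?_
  have heval (i : Fin n) : ∫ ys : Fin n → X, u a (ys i) ∂P = ∫ x, u a x ∂ν :=
    integral_comp_of_measurePreserving (measurePreserving_eval (fun _ => ν) i) (hu a)
  have hinti (i : Fin n) : Integrable (fun ys : Fin n → X => u a (ys i)) P :=
    integrable_of_measurable_of_abs_le ((hu a).comp (measurable_pi_apply i)) fun _ => h a _
  have hmean : ∫ ys : Fin n → X, (∑ i, u a (ys i)) / n ∂P = ∫ x, u a x ∂ν := by
    rw [integral_div, integral_finsetSum _ fun i _ => hinti i]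
    simp [heval, hn']
  have hsumint : Integrable (fun ys : Fin n → X => (∑ i, u a (ys i)) / n) P :=
    (integrable_finsetSum _ fun i _ => hinti i).div_const _
  calc (∑ i, u a (xs i)) / n - ∫ x, u a x ∂ν
      = ∫ ys : Fin n → X, ((∑ i, u a (xs i)) / n - (∑ i, u a (ys i)) / n) ∂P := by
        rw [integral_sub (integrable_const _) hsumint, hmean]
        simp
    _ ≤ _ := by
        refine integral_mono ((integrable_const _).sub hsumint)
          (integrable_of_measurable_of_abs_le (hmc.comp measurable_prodMk_left) fun _ => hb _)
          fun ys => ?_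
        refine le_trans (le_of_eq ?_) (le_signedSup hn (abs_pairDifference_le h) _ _ a)
        simp only [← sub_div, ← Finset.sum_sub_distrib]
        simp [boolSign, pairDifference, MeasurableEquiv.arrowProdEquivProdArrow,
          Equiv.arrowProdEquivProdArrow]

lemma integral_signedSup_pairDifference_le (hn : 1 ≤ n) (hu : ∀ a, Measurable (u a))
    (h : ∀ a x, |u a x| ≤ C) (ν : Measure X) [IsProbabilityMeasure ν] (σ : Fin n → Bool) :
    ∫ z, signedSup (pairDifference u) σ z ∂(Measure.pi fun _ => ν.prod ν) ≤
      (∫ xs, signedSup u σ xs ∂(Measure.pi fun _ => ν)) +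
        ∫ xs, signedSup u (fun i => !σ i) xs ∂(Measure.pi fun _ => ν) := by
  have h1 : MeasurePreserving (fun (z : Fin n → X × X) i => (z i).1)
      (Measure.pi fun _ => ν.prod ν) (Measure.pi fun _ => ν) :=
    measurePreserving_pi _ _ fun _ => measurePreserving_fst
  have h2 : MeasurePreserving (fun (z : Fin n → X × X) i => (z i).2)
      (Measure.pi fun _ => ν.prod ν) (Measure.pi fun _ => ν) :=
    measurePreserving_pi _ _ fun _ => measurePreserving_snd
  have hm1 := measurable_signedSup hu σ
  have hm2 := measurable_signedSup hu fun i => !σ i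
  rw [← integral_comp_of_measurePreserving h1 hm1, ← integral_comp_of_measurePreserving h2 hm2]
  have hi1 : Integrable (fun z : Fin n → X × X => signedSup u σ fun i => (z i).1)
      (Measure.pi fun _ => ν.prod ν) :=
    integrable_of_measurable_of_abs_le (hm1.comp h1.measurable) fun _ =>
      abs_signedSup_le hn h _ _
  have hi2 : Integrable (fun z : Fin n → X × X => signedSup u (fun i => !σ i) fun i => (z i).2)
      (Measure.pi fun _ => ν.prod ν) :=
    integrable_of_measurable_of_abs_le (hm2.comp h2.measurable) fun _ =>
      abs_signedSup_le hn h _ _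
  rw [← integral_add hi1 hi2]
  refine integral_mono
    (integrable_signedSup hn (measurable_pairDifference hu) (abs_pairDifference_le h) _ σ)
    (hi1.add hi2) fun z => ciSup_le fun a => ?_
  refine le_trans (le_of_eq ?_)
    (add_le_add (le_signedSup hn h σ _ a) (le_signedSup hn h (fun i => !σ i) _ a))
  rw [← add_div, ← Finset.sum_add_distrib]
  congr 1
  refine Finset.sum_congr rfl fun i _ => ?_
  rw [boolSign_not, pairDifference]
  ring

lemma integral_expect {κ : Type*} [Fintype κ] {P : Measure X} {F : κ → X → ℝ}
    (hF : ∀ k, Integrable (F k) P) : ∫ x, 𝔼 k, F k x ∂P = 𝔼 k, ∫ x, F k x ∂P := by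
  simp only [Fintype.expect_eq_sum_div_card]
  rw [integral_div, integral_finsetSum _ fun k _ => hF k]

/-- Symmetrization: the expected supremum deviation is at most twice the Rademacher average. -/
lemma integral_supDeviation_le (hn : 1 ≤ n) (hu : ∀ a, Measurable (u a))
    (h : ∀ a x, |u a x| ≤ C) (ν : Measure X) [IsProbabilityMeasure ν] :
    ∫ xs, supDeviation (n := n) ν u xs ∂(Measure.pi fun _ => ν) ≤
      2 * ∫ xs, 𝔼 σ : Fin n → Bool, signedSup u σ xs ∂(Measure.pi fun _ => ν) := by
  refine (integral_supDeviation_le_ghost hn hu h ν).trans ?_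
  rw [integral_expect fun σ => integrable_signedSup hn hu h _ σ]
  set I : (Fin n → Bool) → ℝ := fun σ => ∫ xs, signedSup u σ xs ∂(Measure.pi fun _ => ν)
  calc _ = 𝔼 _σ : Fin n → Bool, ∫ z, signedSup (pairDifference u) (fun _ : Fin n => true) z
        ∂(Measure.pi fun _ => ν.prod ν) := (Fintype.expect_const _).symm
    _ ≤ 𝔼 σ : Fin n → Bool, (I σ + I fun i => !σ i) := by
      refine Finset.expect_le_expect fun σ _ => ?_
      rw [integral_signedSup_pairDifference_eq hu ν σ]
      exact integral_signedSup_pairDifference_le hn hu h ν σ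
    _ = 2 * 𝔼 σ, I σ := by
      rw [Finset.expect_add_distrib, expect_comp_not]
      ring

/-- A one-sided uniform deviation bound for a class with values in `[0, M]`. -/
lemma measureReal_supDeviation_gt_le (hn : 1 ≤ n) (hu : ∀ a, Measurable (u a)) {M : ℝ}
    (h0 : ∀ a x, 0 ≤ u a x) (hM : ∀ a x, u a x ≤ M) (ν : Measure X) [IsProbabilityMeasure ν]
    {η : ℝ} (hη : 0 < η) (hη1 : η ≤ 1) :
    (Measure.pi fun _ => ν).real
      {xs : Fin n → X | 2 * (∫ xs, 𝔼 σ : Fin n → Bool, signedSup u σ xs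
          ∂(Measure.pi fun _ => ν)) + M * √(Real.log (1 / η) / (2 * n)) <
        supDeviation ν u xs} ≤ η := by
  have habs (a : ι) (x : X) : |u a x| ≤ M := abs_le.2 ⟨by linarith [h0 a x, hM a x], hM a x⟩
  have hsymm := integral_supDeviation_le hn hu habs ν
  obtain ⟨a⟩ := ‹Nonempty ι›
  obtain ⟨x⟩ := ν.nonempty_of_neZero
  rcases ((h0 a x).trans (hM a x)).eq_or_lt with hM0 | hM0
  · subst hM0
    have hz (xs : Fin n → X) : supDeviation ν u xs = 0 := by
      simpa using abs_supDeviation_le hn habs ν xs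
    simp only [hz, integral_zero] at hsymm
    simp only [hz, zero_mul, add_zero, hsymm.not_gt]
    simpa using hη.le
  · have hlog : 0 ≤ Real.log (1 / η) := Real.log_nonneg ((one_le_div hη).2 hη1)
    have hn' : (0 : ℝ) < n := by exact_mod_cast hn
    have hmc := measureReal_bounded_differences_le ν (measurable_supDeviation (n := n) hu ν)
      (abs_supDeviation_le hn habs ν) (supDeviation_sub_le hn h0 hM ν)
      (ε := M * √(Real.log (1 / η) / (2 * n))) (by positivity)
    refine (measureReal_mono fun xs hxs => ?_).trans (hmc.trans_eq ?_)
    · simp only [Set.mem_ofPred_eq] at hxs ⊢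
      linarith
    · rw [mul_pow, Real.sq_sqrt (by positivity)]
      have : -2 * (M ^ 2 * (Real.log (1 / η) / (2 * n))) / (n * (M / n) ^ 2) = Real.log η := by
        rw [one_div, Real.log_inv]
        field_simp
      rw [this, Real.exp_log hη]

end Class

lemma rademacherComplexity_image {ι : Type*} (ν : Measure X) (n : ℕ) (G : Set ι)
    (u : ι → X → ℝ) :
    rademacherComplexity ν n (u '' G) =
      ∫ xs, 𝔼 σ : Fin n → Bool, signedSup (fun a : G => u a) σ xs ∂(Measure.pi fun _ => ν) := by
  simp only [rademacherComplexity, Set.image_image, sSup_image', signedSup, boolSign,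
    Fintype.expect_eq_sum_div_card]
  simp

/-- Contraction for the expected Rademacher average of a class that is Lipschitz in
vector-valued functions. -/
lemma integral_expect_signedSup_le {ι : Type*} [Nonempty ι] [Countable ι] {K n : ℕ}
    (hn : 1 ≤ n) {f : ι → X → ℝ} {v : ι → X → EuclideanSpace ℝ (Fin K)} {L C D : ℝ}
    (hL : 0 ≤ L) (hfm : ∀ a, Measurable (f a)) (hfD : ∀ a x, |f a x| ≤ D)
    (hvm : ∀ a, Measurable (v a)) (hvC : ∀ a x k, |v a x k| ≤ C)
    (hfv : ∀ a a' x, |f a x - f a' x| ≤ L * ‖v a x - v a' x‖)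
    (ν : Measure X) [IsProbabilityMeasure ν] :
    ∫ xs, 𝔼 σ : Fin n → Bool, signedSup f σ xs ∂(Measure.pi fun _ => ν) ≤
      √2 * L * ∑ k, ∫ xs, 𝔼 σ : Fin n → Bool, signedSup (fun a x => v a x k) σ xs
        ∂(Measure.pi fun _ => ν) := by
  have hvkm (k : Fin K) (a : ι) : Measurable fun x => v a x k := by
    have := hvm a
    fun_prop
  have hexp {u : ι → X → ℝ} {B : ℝ} (hu : ∀ a, Measurable (u a)) (h : ∀ a x, |u a x| ≤ B) :
      Integrable (fun xs => 𝔼 σ : Fin n → Bool, signedSup u σ xs)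
        (Measure.pi fun _ => ν) := by
    simp only [Fintype.expect_eq_sum_div_card]
    exact (integrable_finsetSum _ fun σ _ => integrable_signedSup hn hu h _ σ).div_const _
  rw [← integral_finsetSum _ fun k _ => hexp (hvkm k) fun a x => hvC a x k,
    ← integral_const_mul]
  refine integral_mono (hexp hfm hfD) ((integrable_finsetSum _ fun k _ =>
    hexp (hvkm k) fun a x => hvC a x k).const_mul _) fun xs => ?_
  have hdiv (u : ι → X → ℝ) (σ : Fin n → Bool) :
      signedSup u σ xs = (⨆ a, ∑ i, boolSign (σ i) * u a (xs i)) / n := by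
    simp only [signedSup, div_eq_mul_inv]
    rw [Real.iSup_mul_of_nonneg (by positivity)]
  simp only [hdiv, ← Finset.expect_div, ← Finset.sum_div]
  rw [← mul_div_assoc]
  exact div_le_div_of_nonneg_right
    (expect_iSup_le_sum_coordinates (ψ := fun i a => f a (xs i)) (v := fun i a => v a (xs i))
      hL (fun i a k => hvC a _ k) (fun i a => hfD a _) fun i a a' => hfv a a' _)
    (by positivity)

end Concentration

/-- A two-sided uniform deviation bound for a class with values in `[0, M]` that is Lipschitz in
vector-valued functions. -/
lemma ofReal_one_sub_le_measure_forall_deviation_le {X ι : Type*} [MeasurableSpace X]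
    [Nonempty ι] [Countable ι] {K n : ℕ}
    (hn : 1 ≤ n) {f : ι → X → ℝ} {v : ι → X → EuclideanSpace ℝ (Fin K)} {L C M : ℝ}
    (hL : 0 ≤ L) (hfm : ∀ a, Measurable (f a)) (hf0 : ∀ a x, 0 ≤ f a x)
    (hfM : ∀ a x, f a x ≤ M) (hvm : ∀ a, Measurable (v a)) (hvC : ∀ a x k, |v a x k| ≤ C)
    (hfv : ∀ a a' x, |f a x - f a' x| ≤ L * ‖v a x - v a' x‖)
    (ν : Measure X) [IsProbabilityMeasure ν] {δ : ℝ} (hδ : δ ∈ Set.Ioo (0 : ℝ) 1) :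
    ENNReal.ofReal (1 - δ) ≤ (Measure.pi fun _ : Fin n => ν)
      {xs | ∀ a, |(∑ i, f a (xs i)) / n - ∫ x, f a x ∂ν| ≤
        2 * (√2 * L * ∑ k, ∫ xs, 𝔼 σ : Fin n → Bool, signedSup (fun a x => v a x k) σ xs
          ∂(Measure.pi fun _ => ν)) + M * √(Real.log (2 / δ) / (2 * n))} := by
  set P : Measure (Fin n → X) := Measure.pi fun _ => ν with hP
  set R : ℝ := √2 * L * ∑ k, ∫ xs, 𝔼 σ : Fin n → Bool, signedSup (fun a x => v a x k) σ xs ∂P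
  set T : ℝ := M * √(Real.log (2 / δ) / (2 * n)) with hT
  have hn' : (n : ℝ) ≠ 0 := by positivity
  have habs {u : ι → X → ℝ} (h0 : ∀ a x, 0 ≤ u a x) (hM : ∀ a x, u a x ≤ M) (a : ι) (x : X) :
      |u a x| ≤ M :=
    abs_le.2 ⟨by linarith [h0 a x, hM a x], hM a x⟩
  have hone {u : ι → X → ℝ} (hum : ∀ a, Measurable (u a)) (h0 : ∀ a x, 0 ≤ u a x)
      (hM : ∀ a x, u a x ≤ M) (huv : ∀ a a' x, |u a x - u a' x| ≤ L * ‖v a x - v a' x‖) :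
      P {xs | 2 * R + T < supDeviation ν u xs} ≤ ENNReal.ofReal (δ / 2) := by
    have hcontr := integral_expect_signedSup_le hn hL hum (habs h0 hM) hvm hvC huv ν
    have h := measureReal_supDeviation_gt_le hn hum h0 hM ν (η := δ / 2) (by linarith [hδ.1])
      (by linarith [hδ.2])
    rw [one_div_div] at h
    rw [← ofReal_measureReal]
    refine ENNReal.ofReal_le_ofReal (le_trans (measureReal_mono fun xs hxs => ?_) h)
    simp only [Set.mem_ofPred_eq] at hxs ⊢
    linarith
  have hM0 (a : ι) (x : X) : 0 ≤ M - f a x := by linarith [hfM a x]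
  have hMM (a : ι) (x : X) : M - f a x ≤ M := by linarith [hf0 a x]
  have h1 := hone hfm hf0 hfM hfv
  have h2 := hone (u := fun a x => M - f a x) (fun a => (hfm a).const_sub M) hM0 hMM
    fun a a' x => by
      rw [sub_sub_sub_cancel_left, abs_sub_comm]
      exact hfv a a' x
  set good : Set (Fin n → X) :=
    {xs | ∀ a, |(∑ i, f a (xs i)) / n - ∫ x, f a x ∂ν| ≤ 2 * R + T}
  have hcover : Set.univ ⊆ good ∪ ({xs | 2 * R + T < supDeviation ν f xs} ∪
      {xs | 2 * R + T < supDeviation ν (fun a x => M - f a x) xs}) := by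
    intro xs _
    by_contra hxs
    simp only [Set.mem_union, not_or, Set.mem_ofPred_eq, not_lt] at hxs
    refine hxs.1 fun a => abs_le.2 ⟨?_, (le_supDeviation hn (habs hf0 hfM) ν xs a).trans hxs.2.1⟩
    have h3 := (le_supDeviation hn (habs hM0 hMM) ν xs a).trans hxs.2.2
    have h4 : ∫ x, (M - f a x) ∂ν = M - ∫ x, f a x ∂ν := by
      rw [integral_sub (integrable_const _)
        (integrable_of_measurable_of_abs_le (hfm a) (habs hf0 hfM a))]
      simp
    have h5 : (∑ i, (M - f a (xs i))) / n = M - (∑ i, f a (xs i)) / n := by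
      rw [Finset.sum_sub_distrib, sub_div]
      simp [hn']
    rw [h4, h5] at h3
    linarith
  have hmeas : 1 ≤ P good + ENNReal.ofReal δ := by
    calc 1 = P Set.univ := measure_univ.symm
      _ ≤ _ := (measure_mono hcover).trans (measure_union_le _ _)
      _ ≤ _ := by
        refine add_le_add le_rfl ((measure_union_le _ _).trans ((add_le_add h1 h2).trans_eq ?_))
        rw [← ENNReal.ofReal_add (by linarith [hδ.1]) (by linarith [hδ.1]), add_halves]
  rw [ENNReal.ofReal_sub _ hδ.1.le, ENNReal.ofReal_one]
  exact tsub_le_iff_right.2 hmeas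

lemma measurable_comp_of_lipschitz_on {X E : Type*} [MeasurableSpace X] [NormedAddCommGroup E]
    [MeasurableSpace E] [BorelSpace E] {S : Set E} {h : E → ℝ} {L : ℝ}
    (hL : ∀ u ∈ S, ∀ u' ∈ S, |h u - h u'| ≤ L * ‖u - u'‖) {g : X → E} (hg : Measurable g)
    (hgS : ∀ x, g x ∈ S) : Measurable fun x => h (g x) := by
  have hlip : LipschitzOnWith L.toNNReal h S := by
    refine LipschitzOnWith.of_dist_le_mul fun u hu u' hu' => ?_
    rw [Real.dist_eq, dist_eq_norm]
    exact (hL u hu u' hu').trans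
      (mul_le_mul_of_nonneg_right (Real.le_coe_toNNReal L) (norm_nonneg _))
  exact (continuousOn_iff_continuous_domRestrict.1 hlip.continuousOn).measurable.comp
    (hg.subtype_mk (h := hgS))

lemma isProbabilityMeasure_normalized_withDensity {X : Type*} [MeasurableSpace X]
    {μ : Measure X} {w : X → ℝ} (hw : Integrable w μ) (hw0 : ∀ x, 0 ≤ w x)
    (hpos : 0 < ∫ x, w x ∂μ) :
    IsProbabilityMeasure ((ENNReal.ofReal (∫ x, w x ∂μ))⁻¹ •
      μ.withDensity fun x => ENNReal.ofReal (w x)) := by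
  refine ⟨?_⟩
  rw [Measure.smul_apply, withDensity_apply _ MeasurableSet.univ, Measure.restrict_univ,
    ← ofReal_integral_eq_lintegral_ofReal hw (ae_of_all _ hw0), smul_eq_mul]
  exact ENNReal.inv_mul_cancel (by simpa using hpos) ENNReal.ofReal_ne_top

/-- **Uniform deviation bound for noise-robust SC-Conf classification.**
With probability at least `1 − δ` over an i.i.d. sample of size `n` from the single-class
conditional distribution `ν = p(x|y_s)`,
`sup_{g ∈ G} |R̂̃(g) − R̃(g)| ≤ (2√2 L_ℓ / C_r) ∑_y Rad_n(G_y, ν)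
  + (C_ℓ / C_r) √(log(2/δ)/(2n))`, where `R̃` is the `φ`-reweighted noisy-confidence risk. -/
theorem norsc_conf_uniform_deviation_bound
    {X : Type*} [MeasurableSpace X] (μ : Measure X) [IsProbabilityMeasure μ]
    {K : ℕ} (hK : 2 ≤ K) (r : Fin K → X → ℝ)
    (hrm : ∀ y, Measurable (r y)) (hr0 : ∀ y x, 0 ≤ r y x)
    (hr1 : ∀ x, ∑ y, r y x = 1)
    (ys : Fin K) (Cr : ℝ) (hCr : Cr ∈ Set.Ioc (0 : ℝ) 1)
    (hrC : ∀ᵐ x ∂μ, Cr ≤ r ys x)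
    (π : ℝ) (hπ : π = ∫ x, r ys x ∂μ) (hπ0 : 0 < π)
    (ν : Measure X)
    (hν : ν = (ENNReal.ofReal π)⁻¹ • μ.withDensity fun x => ENNReal.ofReal (r ys x))
    (rt : Fin K → X → ℝ)
    (hrtm : ∀ y, Measurable (rt y)) (hrt0 : ∀ y x, 0 ≤ rt y x)
    (hrt1 : ∀ x, ∑ y, rt y x = 1)
    (G : Set (X → EuclideanSpace ℝ (Fin K))) (hGc : G.Countable) (hGne : G.Nonempty)
    (hGm : ∀ g ∈ G, Measurable g)
    (Cg : ℝ) (hGb : ∀ g ∈ G, ∀ x, ∀ y, |g x y| ≤ Cg)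
    (ℓ : EuclideanSpace ℝ (Fin K) → Fin K → ℝ) (Cℓ Lℓ : ℝ)
    (hℓb : ∀ u : EuclideanSpace ℝ (Fin K), (∀ y, |u y| ≤ Cg) →
      ∀ y, 0 ≤ ℓ u y ∧ ℓ u y ≤ Cℓ)
    (hℓL : ∀ u u' : EuclideanSpace ℝ (Fin K), (∀ y, |u y| ≤ Cg) → (∀ y, |u' y| ≤ Cg) →
      ∀ y, |ℓ u y - ℓ u' y| ≤ Lℓ * ‖u - u'‖)
    (n : ℕ) (hn : 1 ≤ n) (δ : ℝ) (hδ : δ ∈ Set.Ioo (0 : ℝ) 1) :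
    ENNReal.ofReal (1 - δ) ≤
      (Measure.pi fun _ : Fin n => ν)
        {xs | sSup ((fun g =>
              |(1 / n : ℝ) * ∑ i, (π / r ys (xs i)) * ∑ y, rt y (xs i) * ℓ (g (xs i)) y -
                ∫ x, (π / r ys x) * ∑ y, rt y x * ℓ (g x) y ∂ν|) '' G) ≤
          2 * Real.sqrt 2 * Lℓ / Cr *
              ∑ y, rademacherComplexity ν n ((fun g x => g x y) '' G) +
            Cℓ / Cr * Real.sqrt (Real.log (2 / δ) / (2 * n))} := by
  have : Nonempty G := hGne.to_subtype
  have : Countable G := hGc.to_subtype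
  have hrle (x : X) : r ys x ≤ 1 :=
    (Finset.single_le_sum (fun y _ => hr0 y x) (Finset.mem_univ ys)).trans_eq (hr1 x)
  have hrabs (x : X) : |r ys x| ≤ 1 := by
    rw [abs_of_nonneg (hr0 ys x)]
    exact hrle x
  have hπ1 : π ≤ 1 := hπ ▸ (le_abs_self _).trans (abs_integral_le_of_abs_le hrabs)
  have : IsProbabilityMeasure ν := by
    rw [hν, hπ]
    exact isProbabilityMeasure_normalized_withDensity
      (integrable_of_measurable_of_abs_le (hrm ys) hrabs) (hr0 ys) (hπ ▸ hπ0)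
  have hνμ : ν ≪ μ := hν ▸ Measure.smul_absolutelyContinuous.trans
    (withDensity_absolutelyContinuous _ _)
  have hCr0 : 0 < Cr := hCr.1
  set φ : X → ℝ := fun x => min (π / r ys x) (1 / Cr) with hφ
  have hφae : ∀ᵐ x ∂ν, π / r ys x = φ x := by
    filter_upwards [hνμ.ae_le hrC] with x hx
    exact (min_eq_left (div_le_div₀ zero_le_one hπ1 hCr0 hx)).symm
  have hφ0 (x : X) : 0 ≤ φ x :=
    le_min (div_nonneg hπ0.le (hr0 ys x)) (one_div_nonneg.2 hCr0.le)
  have hφ1 (x : X) : φ x ≤ 1 / Cr := min_le_right _ _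
  have hφm : Measurable φ := ((hrm ys).const_div π).min measurable_const
  set f : G → X → ℝ := fun g x => φ x * ∑ y, rt y x * ℓ (g.1 x) y with hf
  have hℓm (g : G) (y : Fin K) : Measurable fun x => ℓ (g.1 x) y :=
    measurable_comp_of_lipschitz_on (S := {u : EuclideanSpace ℝ (Fin K) | ∀ y, |u y| ≤ Cg})
      (h := fun u => ℓ u y)
      (fun u hu u' hu' => hℓL u u' hu hu' y) (hGm g g.2) (hGb g g.2)
  have hfm (g : G) : Measurable (f g) :=
    hφm.mul (Finset.measurable_fun_sum _ fun y _ => (hrtm y).mul (hℓm g y))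
  have hf0 (g : G) (x : X) : 0 ≤ f g x := mul_nonneg (hφ0 x) (Finset.sum_nonneg fun y _ =>
    mul_nonneg (hrt0 y x) (hℓb _ (hGb g g.2 x) y).1)
  have hfM (g : G) (x : X) : f g x ≤ Cℓ / Cr := by
    have h1 : ∑ y, rt y x * ℓ (g.1 x) y ≤ Cℓ := by
      calc _ ≤ ∑ y, rt y x * Cℓ := Finset.sum_le_sum fun y _ =>
            mul_le_mul_of_nonneg_left (hℓb _ (hGb g g.2 x) y).2 (hrt0 y x)
        _ = Cℓ := by rw [← Finset.sum_mul, hrt1, one_mul]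
    have hCℓ : 0 ≤ Cℓ := (hℓb _ (hGb g g.2 x) ys).1.trans (hℓb _ (hGb g g.2 x) ys).2
    calc f g x ≤ φ x * Cℓ := mul_le_mul_of_nonneg_left h1 (hφ0 x)
      _ ≤ 1 / Cr * Cℓ := mul_le_mul_of_nonneg_right (hφ1 x) hCℓ
      _ = Cℓ / Cr := by ring
  have hflip (g g' : G) (x : X) : |f g x - f g' x| ≤ max Lℓ 0 / Cr * ‖g.1 x - g'.1 x‖ := by
    have h1 : |∑ y, rt y x * ℓ (g.1 x) y - ∑ y, rt y x * ℓ (g'.1 x) y| ≤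
        max Lℓ 0 * ‖g.1 x - g'.1 x‖ := by
      rw [← Finset.sum_sub_distrib]
      calc _ ≤ ∑ y, rt y x * (max Lℓ 0 * ‖g.1 x - g'.1 x‖) := by
            refine (Finset.abs_sum_le_sum_abs _ _).trans (Finset.sum_le_sum fun y _ => ?_)
            rw [← mul_sub, abs_mul, abs_of_nonneg (hrt0 y x)]
            refine mul_le_mul_of_nonneg_left ?_ (hrt0 y x)
            exact (hℓL _ _ (hGb g g.2 x) (hGb g' g'.2 x) y).trans
              (mul_le_mul_of_nonneg_right (le_max_left _ _) (norm_nonneg _))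
        _ = _ := by rw [← Finset.sum_mul, hrt1, one_mul]
    calc |f g x - f g' x|
        = φ x * |∑ y, rt y x * ℓ (g.1 x) y - ∑ y, rt y x * ℓ (g'.1 x) y| := by
          rw [hf, ← mul_sub, abs_mul, abs_of_nonneg (hφ0 x)]
      _ ≤ 1 / Cr * (max Lℓ 0 * ‖g.1 x - g'.1 x‖) :=
          mul_le_mul (hφ1 x) h1 (abs_nonneg _) (one_div_nonneg.2 hCr0.le)
      _ = _ := by ring
  have hmain := ofReal_one_sub_le_measure_forall_deviation_le hn (v := fun g : G => g.1)
    (div_nonneg (le_max_right Lℓ 0) hCr0.le) hfm hf0 hfM (fun g => hGm g g.2)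
    (fun g => hGb g g.2) hflip ν hδ
  refine hmain.trans (measure_mono_ae ?_)
  have hsample : ∀ᵐ xs ∂(Measure.pi fun _ : Fin n => ν), ∀ i, π / r ys (xs i) = φ (xs i) :=
    ae_all_iff.2 fun i =>
      (measurePreserving_eval (fun _ : Fin n => ν) i).quasiMeasurePreserving.ae hφae
  have hconst : 2 * (√2 * (max Lℓ 0 / Cr) * ∑ k, ∫ xs, 𝔼 σ : Fin n → Bool,
        signedSup (fun (g : G) x => g.1 x k) σ xs ∂(Measure.pi fun _ => ν)) =
      2 * √2 * Lℓ / Cr * ∑ y, rademacherComplexity ν n ((fun g x => g x y) '' G) := by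
    simp only [rademacherComplexity_image]
    rcases le_or_gt 0 Lℓ with hL | hL
    · rw [max_eq_left hL]
      ring
    · have hzero (g : G) (x : X) : g.1 x = 0 := by
        have h1 := (abs_nonneg _).trans (hℓL (g.1 x) (-g.1 x) (hGb g g.2 x)
          (fun y => by simpa using hGb g g.2 x y) ys)
        have h2 : ‖g.1 x - -g.1 x‖ = 0 :=
          le_antisymm (nonpos_of_mul_nonneg_right h1 hL) (norm_nonneg _)
        have h3 : (2 : ℝ) • g.1 x = 0 := by
          rw [two_smul, ← sub_neg_eq_add]
          exact norm_eq_zero.1 h2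
        exact (smul_eq_zero.1 h3).resolve_left two_ne_zero
      simp [hzero, signedSup]
  filter_upwards [hsample] with xs hxs hgood
  refine csSup_le (hGne.image _) ?_
  rintro _ ⟨g, hg, rfl⟩
  have h1 : ∫ x, (π / r ys x) * ∑ y, rt y x * ℓ (g x) y ∂ν = ∫ x, f ⟨g, hg⟩ x ∂ν := by
    refine integral_congr_ae ?_
    filter_upwards [hφae] with x hx
    rw [hx]
  have h2 := hgood ⟨g, hg⟩
  rw [hconst] at h2
  simp only [hxs, h1]
  rw [one_div_mul_eq_div]
  exact h2
end

section
/- π_{Y_s} · ∫_X (∑_{y : Fin K} (r y x / (∑_{y_s ∈ Y_s} r y_s x)) · L x y) dν_{Y_s}(x) = ∫_X (∑_{y : Fin K} r y x · L x y) dμ(x). That is, the multi-class classification risk is recovered from data drawn from the conditional distribution given y ∈ Y_s, weighted by the confidence ratios p(y|x)/(∑_{y_s∈Y_s} p(y_s|x)) and scaled by the prior π_{Y_s} = ∑_{y_s∈Y_s} π_{y_s}. (Sub-Conf classification, Theorem 6.) -/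
open MeasureTheory

/-- **Sub-Conf risk rewriting (Theorem 6).**
The multi-class classification risk is recovered from data drawn from the conditional
distribution given `y ∈ Y_s`, weighted by the confidence ratios
`p(y|x) / ∑_{y_s ∈ Y_s} p(y_s|x)` and scaled by the prior `π_{Y_s} = ∑_{y_s ∈ Y_s} π_{y_s}`. -/
theorem sub_conf_unbiased_risk
    {X : Type*} [MeasurableSpace X] (μ : Measure X) [IsProbabilityMeasure μ]
    {K : ℕ} (hK : 2 ≤ K) (r : Fin K → X → ℝ)
    (hrm : ∀ y, Measurable (r y)) (hr0 : ∀ y x, 0 ≤ r y x)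
    (hr1 : ∀ x, ∑ y, r y x = 1)
    (Ys : Finset (Fin K)) (hYs : Ys.Nonempty)
    (hpos : ∀ᵐ x ∂μ, 0 < ∑ ys ∈ Ys, r ys x)
    (πY : ℝ) (hπY : πY = ∫ x, ∑ ys ∈ Ys, r ys x ∂μ) (hπY0 : 0 < πY)
    (ν : Measure X)
    (hν : ν = (ENNReal.ofReal πY)⁻¹ •
      μ.withDensity fun x => ENNReal.ofReal (∑ ys ∈ Ys, r ys x))
    (L : X → Fin K → ℝ) (hLm : ∀ y, Measurable fun x => L x y)
    (hL0 : ∀ x y, 0 ≤ L x y)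
    (hint : Integrable (fun x => ∑ y, r y x * L x y) μ) :
    πY * ∫ x, ∑ y, r y x / (∑ ys ∈ Ys, r ys x) * L x y ∂ν =
      ∫ x, ∑ y, r y x * L x y ∂μ := by
  have hS : Measurable fun x => ENNReal.ofReal (∑ ys ∈ Ys, r ys x) :=
    (Finset.measurable_fun_sum Ys fun y _ => hrm y).ennreal_ofReal
  rw [hν, integral_smul_measure,
    integral_withDensity_eq_integral_toReal_smul hS (.of_forall fun _ => ENNReal.ofReal_lt_top),
    ENNReal.toReal_inv, ENNReal.toReal_ofReal hπY0.le, smul_eq_mul,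
    mul_inv_cancel_left₀ hπY0.ne']
  refine integral_congr_ae ?_
  filter_upwards [hpos] with x hx
  rw [ENNReal.toReal_ofReal hx.le, smul_eq_mul, Finset.mul_sum]
  refine Finset.sum_congr rfl fun y _ => ?_
  rw [← mul_assoc, mul_div_cancel₀ _ hx.ne']
end

section
/- For any weights α : Y_s → ℝ with α_{y_s} ≥ 0 for all y_s ∈ Y_s and ∑_{y_s ∈ Y_s} α_{y_s} = 1, one has ∑_{y_s ∈ Y_s} α_{y_s} · π_{y_s} · ∫_X (∑_{y : Fin K} (r y x / r y_s x) · L x y) dν_{y_s}(x) = ∫_X (∑_{y : Fin K} r y x · L x y) dμ(x). That is, any convex combination over y_s ∈ Y_s of the single-class confidence-weighted risks equals the ordinary multi-class classification risk. -/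
open MeasureTheory

/-- **Convex combination of single-class confidence-weighted risks (Remark 2).**
For any convex-combination weights `α` over `Y_s`, the `α`-weighted combination of the
single-class confidence-weighted risks over the classes `y_s ∈ Y_s` equals the ordinary
multi-class classification risk. -/
theorem convex_combination_sc_conf_risks
    {X : Type*} [MeasurableSpace X] (μ : Measure X) [IsProbabilityMeasure μ]
    {K : ℕ} (hK : 2 ≤ K) (r : Fin K → X → ℝ)
    (hrm : ∀ y, Measurable (r y)) (hr0 : ∀ y x, 0 ≤ r y x)
    (hr1 : ∀ x, ∑ y, r y x = 1)
    (Ys : Finset (Fin K)) (hYs : Ys.Nonempty)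
    (hpos : ∀ ys ∈ Ys, ∀ᵐ x ∂μ, 0 < r ys x)
    (πs : Fin K → ℝ) (hπs : ∀ ys ∈ Ys, πs ys = ∫ x, r ys x ∂μ)
    (hπs0 : ∀ ys ∈ Ys, 0 < πs ys)
    (ν : Fin K → Measure X)
    (hν : ∀ ys ∈ Ys, ν ys = (ENNReal.ofReal (πs ys))⁻¹ •
      μ.withDensity fun x => ENNReal.ofReal (r ys x))
    (L : X → Fin K → ℝ) (hLm : ∀ y, Measurable fun x => L x y)
    (hL0 : ∀ x y, 0 ≤ L x y)
    (hint : Integrable (fun x => ∑ y, r y x * L x y) μ)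
    (hint' : ∀ ys ∈ Ys, Integrable (fun x => ∑ y, r y x / r ys x * L x y) (ν ys))
    (α : Fin K → ℝ) (hα0 : ∀ ys ∈ Ys, 0 ≤ α ys) (hα1 : ∑ ys ∈ Ys, α ys = 1) :
    ∑ ys ∈ Ys, α ys * (πs ys * ∫ x, ∑ y, r y x / r ys x * L x y ∂(ν ys)) =
      ∫ x, ∑ y, r y x * L x y ∂μ := by
  have risk_eq : ∀ ys ∈ Ys, πs ys * ∫ x, ∑ y, r y x / r ys x * L x y ∂(ν ys) =
      ∫ x, ∑ y, r y x * L x y ∂μ := by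
    intro ys hys
    rw [hν ys hys, integral_smul_measure, ENNReal.toReal_inv,
      ENNReal.toReal_ofReal (hπs0 ys hys).le, smul_eq_mul,
      mul_inv_cancel_left₀ (hπs0 ys hys).ne',
      integral_withDensity_eq_integral_toReal_smul (hrm ys).ennreal_ofReal
        (.of_forall fun _ => ENNReal.ofReal_lt_top)]
    refine integral_congr_ae ?_
    filter_upwards [hpos ys hys] with x hx
    rw [ENNReal.toReal_ofReal hx.le, smul_eq_mul, Finset.mul_sum]
    refine Finset.sum_congr rfl fun y _ => ?_
    rw [← mul_assoc, mul_div_cancel₀ _ hx.ne']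
  rw [Finset.sum_congr rfl fun ys hys => by rw [risk_eq ys hys], ← Finset.sum_mul, hα1, one_mul]
end

section
/- For any fixed samples (x_1,…,x_n) ∈ Xⁿ and (x^u_1,…,x^u_{n_u}) ∈ X^{n_u}, if φ̂* ∈ Φ satisfies Ĵ(φ̂*) ≤ Ĵ(φ̂) for all φ̂ ∈ Φ (φ̂* is an empirical minimizer of the Bregman objective), then B_η(φ‖φ̂*) ≤ 2 · sup_{φ̂ ∈ Φ} |Ĵ_SC(φ̂) − J_SC(φ̂)| + 2 · sup_{φ̂ ∈ Φ} |Ĵ_U(φ̂) − J_U(φ̂)|. (Key steps: B_η(φ‖φ̂) = J_SC(φ̂) + J_U(φ̂) + ∫ η(φ) dν for every φ̂ ∈ Φ, since ∫ η'(φ̂) φ dν = ∫ η'(φ̂) dμ, and B_η(φ‖φ) = 0.) -/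
open MeasureTheory

/-- Integration against a measure with density `φ ≥ 0` is integration of the product with `φ`. -/
theorem integrable_and_integral_withDensity_ofReal {X : Type*} [MeasurableSpace X] {ν : Measure X}
    {φ g : X → ℝ} (hφm : Measurable φ) (hφ0 : ∀ x, 0 ≤ φ x)
    (hg : Integrable g (ν.withDensity fun x => ENNReal.ofReal (φ x))) :
    Integrable (fun x => φ x * g x) ν ∧
      ∫ x, φ x * g x ∂ν = ∫ x, g x ∂(ν.withDensity fun x => ENNReal.ofReal (φ x)) := by
  have hfin : ∀ᵐ x ∂ν, ENNReal.ofReal (φ x) < ⊤ := by simp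
  constructor
  · simpa [ENNReal.toReal_ofReal (hφ0 _)] using
      (integrable_withDensity_iff_integrable_smul' hφm.ennreal_ofReal hfin).1 hg
  · simp [integral_withDensity_eq_integral_toReal_smul hφm.ennreal_ofReal hfin,
      ENNReal.toReal_ofReal (hφ0 _)]

/-- The Bregman divergence from a density ratio `φ` splits into a part integrated against `ν`, a part
integrated against the measure with density `φ`, and a constant. -/
theorem integral_bregman_eq {X : Type*} [MeasurableSpace X] {ν : Measure X}
    {φ f : X → ℝ} {η η' : ℝ → ℝ} (hφm : Measurable φ) (hφ0 : ∀ x, 0 ≤ φ x)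
    (hηφ : Integrable (fun x => η (φ x)) ν)
    (hsc : Integrable (fun x => η' (f x) * f x - η (f x)) ν)
    (hu : Integrable (fun x => η' (f x)) (ν.withDensity fun x => ENNReal.ofReal (φ x))) :
    ∫ x, (η (φ x) - η (f x) - η' (f x) * (φ x - f x)) ∂ν =
      ∫ x, (η' (f x) * f x - η (f x)) ∂ν -
        ∫ x, η' (f x) ∂(ν.withDensity fun x => ENNReal.ofReal (φ x)) + ∫ x, η (φ x) ∂ν := by
  obtain ⟨hi, he⟩ := integrable_and_integral_withDensity_ofReal hφm hφ0 hu
  rw [← he, ← integral_sub hsc hi, ← integral_add (by exact hsc.sub hi) hηφ]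
  congr 1 with x
  ring

/-- **Deterministic ERM bound for density-ratio estimation.**
If `φ̂*` is an empirical minimizer of the empirical Bregman objective
`Ĵ = Ĵ_SC + Ĵ_U`, then the Bregman divergence `B_η(φ‖φ̂*)` between the true density ratio
`φ` and `φ̂*` is at most `2 sup_{φ̂ ∈ Φ} |Ĵ_SC(φ̂) − J_SC(φ̂)| + 2 sup_{φ̂ ∈ Φ} |Ĵ_U(φ̂) − J_U(φ̂)|`. -/
theorem density_ratio_erm_deterministic_bound
    {X : Type*} [MeasurableSpace X] (ν μ : Measure X)
    [IsProbabilityMeasure ν] [IsProbabilityMeasure μ]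
    (φ : X → ℝ) (hφm : Measurable φ) (hφ0 : ∀ x, 0 ≤ φ x)
    (hμν : μ = ν.withDensity fun x => ENNReal.ofReal (φ x))
    (η η' : ℝ → ℝ) (hηd : ∀ t, HasDerivAt η (η' t) t)
    (hηc : ConvexOn ℝ Set.univ η)
    (Φ : Set (X → ℝ)) (hΦc : Φ.Countable) (hΦne : Φ.Nonempty)
    (hΦm : ∀ f ∈ Φ, Measurable f)
    (CΦ : ℝ) (hΦb : ∀ f ∈ Φ, ∀ x, |f x| ≤ CΦ) (hφΦ : φ ∈ Φ)
    (hint1 : ∀ f ∈ Φ, Integrable (fun x => η (φ x) - η (f x) - η' (f x) * (φ x - f x)) ν)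
    (hint2 : ∀ f ∈ Φ, Integrable (fun x => η' (f x) * f x - η (f x)) ν)
    (hint3 : ∀ f ∈ Φ, Integrable (fun x => η' (f x)) μ)
    (n nu : ℕ) (hn : 1 ≤ n) (hnu : 1 ≤ nu)
    (xs : Fin n → X) (xus : Fin nu → X)
    (hbdd1 : BddAbove ((fun f =>
        |(1 / n : ℝ) * ∑ i, (η' (f (xs i)) * f (xs i) - η (f (xs i))) -
          ∫ x, (η' (f x) * f x - η (f x)) ∂ν|) '' Φ))
    (hbdd2 : BddAbove ((fun f =>
        |-((1 / nu : ℝ) * ∑ j, η' (f (xus j))) - -∫ x, η' (f x) ∂μ|) '' Φ))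
    (φstar : X → ℝ) (hφstar : φstar ∈ Φ)
    (hmin : ∀ f ∈ Φ,
      (1 / n : ℝ) * ∑ i, (η' (φstar (xs i)) * φstar (xs i) - η (φstar (xs i))) -
          (1 / nu : ℝ) * ∑ j, η' (φstar (xus j)) ≤
        (1 / n : ℝ) * ∑ i, (η' (f (xs i)) * f (xs i) - η (f (xs i))) -
          (1 / nu : ℝ) * ∑ j, η' (f (xus j))) :
    ∫ x, (η (φ x) - η (φstar x) - η' (φstar x) * (φ x - φstar x)) ∂ν ≤
      2 * sSup ((fun f =>
          |(1 / n : ℝ) * ∑ i, (η' (f (xs i)) * f (xs i) - η (f (xs i))) -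
            ∫ x, (η' (f x) * f x - η (f x)) ∂ν|) '' Φ) +
        2 * sSup ((fun f =>
          |-((1 / nu : ℝ) * ∑ j, η' (f (xus j))) - -∫ x, η' (f x) ∂μ|) '' Φ) := by
  subst hμν
  have hηφ : Integrable (fun x => η (φ x)) ν := by
    have hi := (integrable_and_integral_withDensity_ofReal hφm hφ0 (hint3 φ hφΦ)).1
    refine (hi.sub (hint2 φ hφΦ)).congr (.of_forall fun x => ?_)
    simp only [Pi.sub_apply]
    ring
  have hself := integral_bregman_eq hφm hφ0 hηφ (hint2 φ hφΦ) (hint3 φ hφΦ)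
  simp only [sub_self, mul_zero, integral_zero] at hself
  rw [integral_bregman_eq hφm hφ0 hηφ (hint2 φstar hφstar) (hint3 φstar hφstar)]
  have hsc := abs_le.1 (le_csSup hbdd1 (Set.mem_image_of_mem _ hφΦ))
  have hscStar := abs_le.1 (le_csSup hbdd1 (Set.mem_image_of_mem _ hφstar))
  have hu := abs_le.1 (le_csSup hbdd2 (Set.mem_image_of_mem _ hφΦ))
  have huStar := abs_le.1 (le_csSup hbdd2 (Set.mem_image_of_mem _ hφstar))
  linarith [hmin φ hφΦ, hsc.2, hscStar.1, hu.2, huStar.1]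
end
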